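/- arXiv:math/0011140 — 2 statements merged into one kernel-verified Lean document; each statement's English description precedes it below -/
import Mathlib

section
/- Let A be a unital C*-algebra, let α be a flow on A, and let σ be a *-automorphism of A such that σ ∘ α_t = α_t ∘ σ for all t ∈ ℝ. Suppose σ is α-smoothly approximately inner, i.e., there is a sequence (u_n) of unitaries of A with each u_n in the domain D(δ_α), such that ‖u_n x u_n* − σ(x)‖ → 0 for every x ∈ A and sup_n ‖δ_α(u_n)‖ < ∞. Then for every c ∈ ℝ and every α-KMS state ω at inverse temperature c, one has ω ∘ σ = ω. -/
open Filter Topology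

/-- `HasGenDeriv α x y` : `x` is in the domain of the generator `δ_α` of the flow
`α` and `δ_α(x) = y`. -/
def HasGenDeriv {A : Type*} [NormedRing A] [StarRing A] [CStarRing A]
    [NormedAlgebra ℂ A] [CompleteSpace A] [StarModule ℂ A]
    (α : ℝ → A ≃⋆ₐ[ℂ] A) (x y : A) : Prop :=
  Tendsto (fun t : ℝ => t⁻¹ • (α t x - x)) (𝓝[≠] (0 : ℝ)) (𝓝 y)

/-- `IsKMSState α c ω` : `ω` is an `α`-KMS state at inverse temperature `c`.
For `c = 0` this means an `α`-invariant tracial state; for `c ≠ 0` it is the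
usual KMS condition in terms of bounded continuous functions on the strip
`S_c = {z : ℂ | Im z between 0 and c}`, holomorphic in the interior. -/
def IsKMSState {A : Type*} [NormedRing A] [StarRing A] [CStarRing A]
    [NormedAlgebra ℂ A] [CompleteSpace A] [StarModule ℂ A]
    (α : ℝ → A ≃⋆ₐ[ℂ] A) (c : ℝ) (ω : A → ℂ) : Prop :=
  ω 1 = 1 ∧
  (∀ (s : ℂ) (x y : A), ω (s • x + y) = s * ω x + ω y) ∧
  (∀ x : A, ∃ r : ℝ, 0 ≤ r ∧ ω (star x * x) = (r : ℂ)) ∧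
  (if c = 0 then
    (∀ (t : ℝ) (x : A), ω (α t x) = ω x) ∧ (∀ x y : A, ω (x * y) = ω (y * x))
  else
    ∀ x y : A, ∃ F : ℂ → ℂ,
      ContinuousOn F {z : ℂ | z.im ∈ Set.uIcc 0 c} ∧
      (∃ M : ℝ, ∀ z ∈ {z : ℂ | z.im ∈ Set.uIcc 0 c}, ‖F z‖ ≤ M) ∧
      DifferentiableOn ℂ F (interior {z : ℂ | z.im ∈ Set.uIcc 0 c}) ∧
      (∀ t : ℝ, F (t : ℂ) = ω (x * α t y)) ∧
      (∀ t : ℝ, F ((t : ℂ) + (c : ℂ) * Complex.I) = ω (α t y * x)))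

section SmearedKMS

open MeasureTheory Complex

variable {A : Type*} [NormedRing A] [StarRing A] [CStarRing A] [NormedAlgebra ℂ A]
    [CompleteSpace A] [StarModule ℂ A]

lemma IsSelfAdjoint.exists_smul_one_sub_eq_star_mul_self {h : A} (hh : IsSelfAdjoint h) {r : ℝ}
    (hr : ‖h‖ ≤ r) : ∃ y : A, (r : ℂ) • (1 : A) - h = star y * y := by
  let : CStarAlgebra A := {}
  let := CStarAlgebra.spectralOrder A
  let := CStarAlgebra.spectralOrderedRing A
  have h1 : h ≤ algebraMap ℝ A r :=
    hh.le_algebraMap_norm_self.trans (algebraMap_mono A hr)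
  obtain ⟨y, hy⟩ := CStarAlgebra.nonneg_iff_eq_star_mul_self.1 (sub_nonneg.2 h1)
  refine ⟨y, ?_⟩
  rw [← hy, Algebra.algebraMap_eq_smul_one]
  rfl

lemma StarAlgEquiv.norm_map_eq (φ : A ≃⋆ₐ[ℂ] A) (x : A) : ‖φ x‖ = ‖x‖ := by
  let : CStarAlgebra A := {}
  exact StarAlgEquiv.norm_map φ x

omit [NormedAlgebra ℂ A] [CompleteSpace A] [StarModule ℂ A] in
lemma norm_le_one_of_mem_unitary {u : A} (hu : u ∈ unitary A) : ‖u‖ ≤ 1 := by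
  cases subsingleton_or_nontrivial A
  · simp [Subsingleton.elim u 0]
  · exact (CStarRing.norm_of_mem_unitary hu).le

/-- Normalization, linearity and positivity of a functional. -/
def IsStateFun (ω : A → ℂ) : Prop :=
  ω 1 = 1 ∧ (∀ (s : ℂ) (x y : A), ω (s • x + y) = s * ω x + ω y) ∧
    ∀ x : A, 0 ≤ (ω (star x * x)).re ∧ (ω (star x * x)).im = 0

omit [CStarRing A] [CompleteSpace A] [StarModule ℂ A] in
lemma IsStateFun.map_zero {ω : A → ℂ} (h : IsStateFun ω) : ω 0 = 0 := by
  simpa using h.2.1 1 0 0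

/-- The underlying linear map of a state. -/
def IsStateFun.toLinearMap {ω : A → ℂ} (h : IsStateFun ω) : A →ₗ[ℂ] ℂ where
  toFun := ω
  map_add' x y := by simpa using h.2.1 1 x y
  map_smul' s x := by simpa [h.map_zero] using h.2.1 s x 0

lemma IsStateFun.conj_bounds {ω : A → ℂ} (hω : IsStateFun ω) {h : A} (hh : IsSelfAdjoint h) {r : ℝ}
    (hr : ‖h‖ ≤ r) (x : A) :
    |(ω (star x * h * x)).re| ≤ r * (ω (star x * x)).re ∧ (ω (star x * h * x)).im = 0 := by
  have key : ∀ k : A, IsSelfAdjoint k → ‖k‖ ≤ r →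
      (ω (star x * k * x)).re ≤ r * (ω (star x * x)).re ∧ (ω (star x * k * x)).im = 0 := by
    intro k hk hkr
    obtain ⟨y, hy⟩ := hk.exists_smul_one_sub_eq_star_mul_self hkr
    have h1 : star (y * x) * (y * x) = (r : ℂ) • (star x * x) - star x * k * x := by
      rw [star_mul, mul_assoc, ← mul_assoc (star y), ← hy]
      simp [mul_sub, sub_mul, mul_assoc]
    have h2 : ω (star (y * x) * (y * x)) = r * ω (star x * x) - ω (star x * k * x) := by
      rw [h1]
      have := (hω.toLinearMap).map_sub ((r : ℂ) • (star x * x)) (star x * k * x)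
      rw [map_smul] at this
      exact this
    obtain ⟨p, q⟩ := hω.2.2 (y * x)
    have p' := (hω.2.2 x).2
    rw [h2] at p q
    simp [p'] at p q
    exact ⟨p, q⟩
  obtain ⟨a, b⟩ := key h hh hr
  obtain ⟨c, -⟩ := key (-h) hh.neg (by simpa using hr)
  have h3 : ω (star x * -h * x) = - ω (star x * h * x) := by
    have := (hω.toLinearMap).map_neg (star x * h * x)
    simp only [mul_neg, neg_mul]
    exact this
  rw [h3, neg_re] at c
  exact ⟨abs_le.2 ⟨by linarith, a⟩, b⟩

lemma IsStateFun.norm_le_of_isSelfAdjoint {ω : A → ℂ} (hω : IsStateFun ω) {h : A}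
    (hh : IsSelfAdjoint h) : ‖ω h‖ ≤ ‖h‖ := by
  obtain ⟨a, b⟩ := hω.conj_bounds hh le_rfl 1
  simp only [star_one, one_mul, mul_one, hω.1, one_re] at a b
  have : ω h = ((ω h).re : ℂ) := Complex.ext (by simp) (by simp [b])
  rw [this, norm_real]
  exact a

lemma IsStateFun.norm_le {ω : A → ℂ} (hω : IsStateFun ω) (x : A) : ‖ω x‖ ≤ 2 * ‖x‖ := by
  have h1 : ω x = ω (realPart x : A) + I * ω (imaginaryPart x : A) := by
    conv_lhs => rw [← realPart_add_I_smul_imaginaryPart x]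
    have := hω.2.1 I (imaginaryPart x : A) (realPart x : A)
    rw [add_comm, this, add_comm]
  have h2 := hω.norm_le_of_isSelfAdjoint (realPart x).2
  have h3 := hω.norm_le_of_isSelfAdjoint (imaginaryPart x).2
  have h4 : ‖(realPart x : A)‖ ≤ ‖x‖ := realPart.norm_le x
  have h5 : ‖(imaginaryPart x : A)‖ ≤ ‖x‖ := imaginaryPart.norm_le x
  rw [h1]
  refine (norm_add_le _ _).trans ?_
  rw [norm_mul, norm_I, one_mul]
  linarith

/-- A state as a continuous linear functional. -/
noncomputable def IsStateFun.toCLM {ω : A → ℂ} (h : IsStateFun ω) : A →L[ℂ] ℂ :=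
  h.toLinearMap.mkContinuous 2 h.norm_le

lemma IsStateFun.toCLM_apply {ω : A → ℂ} (h : IsStateFun ω) (x : A) : h.toCLM x = ω x := rfl

/-- The Gaussian `exp (-b z ^ 2)` along the line `Im z = -c`. -/
noncomputable def gaussLine (b c s : ℝ) : ℂ := cexp (-(b : ℂ) * ((s : ℂ) - c * I) ^ 2)

lemma continuous_gaussLine (b c : ℝ) : Continuous (gaussLine b c) := by
  unfold gaussLine
  fun_prop

lemma norm_gaussLine (b c s : ℝ) :
    ‖gaussLine b c s‖ = Real.exp (b * c ^ 2) * Real.exp (-b * s ^ 2) := by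
  rw [gaussLine, norm_exp, ← Real.exp_add]
  congr 1
  simp [pow_two]
  ring

lemma integrable_norm_gaussLine {b : ℝ} (hb : 0 < b) (c : ℝ) :
    Integrable (fun s => ‖gaussLine b c s‖) := by
  simp only [norm_gaussLine]
  exact (integrable_exp_neg_mul_sq hb).const_mul _

lemma integrable_gaussLine_smul {E : Type*} [NormedAddCommGroup E] [NormedSpace ℂ E]
    {b : ℝ} (hb : 0 < b) (c : ℝ)
    {v : ℝ → E} (hv : Continuous v) {C : ℝ} (hC : ∀ s, ‖v s‖ ≤ C) :
    Integrable (fun s => gaussLine b c s • v s) := by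
  refine ((integrable_norm_gaussLine hb c).mul_const C).mono'
    ((continuous_gaussLine b c).smul hv).aestronglyMeasurable (.of_forall fun s => ?_)
  rw [norm_smul]
  gcongr
  exact hC s

/-- The average of `α s x` against the Gaussian `gaussLine b c`. -/
noncomputable def smear (α : ℝ → A ≃⋆ₐ[ℂ] A) (b c : ℝ) (x : A) : A :=
  ∫ s : ℝ, gaussLine b c s • α s x

lemma integrable_smear {α : ℝ → A ≃⋆ₐ[ℂ] A} (hα : ∀ x : A, Continuous fun t : ℝ => α t x)
    {b : ℝ} (hb : 0 < b) (c : ℝ) (x : A) : Integrable (fun s : ℝ => gaussLine b c s • α s x) :=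
  integrable_gaussLine_smul hb c (hα x) fun s => ((α s).norm_map_eq x).le

lemma map_smear {α : ℝ → A ≃⋆ₐ[ℂ] A} (hα : ∀ x : A, Continuous fun t : ℝ => α t x)
    {E : Type*} [NormedAddCommGroup E] [NormedSpace ℂ E] [CompleteSpace E] (L : A →L[ℂ] E)
    {b : ℝ} (hb : 0 < b) (c : ℝ) (x : A) :
    L (smear α b c x) = ∫ s : ℝ, gaussLine b c s • L (α s x) := by
  rw [smear, ← L.integral_comp_comm (integrable_smear hα hb c x)]
  simp

/-- States satisfying the KMS condition on Gaussian-smoothed elements. -/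
def smearedKMS (α : ℝ → A ≃⋆ₐ[ℂ] A) (c : ℝ) : Set (A → ℂ) :=
  {ω | IsStateFun ω ∧ ∀ b : ℝ, 0 < b → ∀ x y : A,
    ω (x * smear α b c y) = ω (smear α b 0 y * x)}

lemma tendsto_gauss_vertical {c b M : ℝ} (hb : 0 < b) {F : ℂ → ℂ}
    (hM : ∀ z : ℂ, z.im ∈ Set.uIcc 0 c → ‖F z‖ ≤ M) {l : Filter ℝ} {T : ℝ → ℝ}
    (hT : Tendsto (fun t => T t ^ 2) l atTop) :
    Tendsto (fun t => ∫ y in (0 : ℝ)..c,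
      cexp (-(b : ℂ) * ((T t + y * I) - c * I) ^ 2) * F (T t + y * I)) l (𝓝 0) := by
  have hlim : Tendsto (fun t => Real.exp (b * c ^ 2) * Real.exp (-(b * T t ^ 2)) * M * |c - 0|)
      l (𝓝 0) := by
    have h1 : Tendsto (fun t => Real.exp (-(b * T t ^ 2))) l (𝓝 0) :=
      Real.tendsto_exp_neg_atTop_nhds_zero.comp (hT.const_mul_atTop hb)
    simpa using ((h1.const_mul (Real.exp (b * c ^ 2))).mul_const M).mul_const |c - 0|
  refine squeeze_zero_norm (fun t => ?_) hlim
  refine intervalIntegral.norm_integral_le_of_norm_le_const fun y hy => ?_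
  have hy' : y ∈ Set.uIcc 0 c := Set.uIoc_subset_uIcc hy
  have h2 : ‖F (T t + y * I)‖ ≤ M := hM _ (by simpa using hy')
  have h3 : (y - c) ^ 2 ≤ c ^ 2 := by
    rw [sq_le_sq]
    simpa [abs_sub_comm] using Set.abs_sub_right_of_mem_uIcc hy'
  have h4 : ‖cexp (-(b : ℂ) * ((T t + y * I) - c * I) ^ 2)‖ ≤
      Real.exp (b * c ^ 2) * Real.exp (-(b * T t ^ 2)) := by
    rw [norm_exp, ← Real.exp_add, Real.exp_le_exp]
    have : (-(b : ℂ) * ((T t + y * I) - c * I) ^ 2).re = b * (y - c) ^ 2 - b * T t ^ 2 := by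
      simp [pow_two]
      ring
    rw [this]
    nlinarith
  rw [norm_mul]
  gcongr

lemma integral_gaussLine_shift {c b : ℝ} (hb : 0 < b) {F : ℂ → ℂ}
    (hF : ContinuousOn F {z : ℂ | z.im ∈ Set.uIcc 0 c}) {M : ℝ}
    (hM : ∀ z : ℂ, z.im ∈ Set.uIcc 0 c → ‖F z‖ ≤ M)
    (hd : DifferentiableOn ℂ F (interior {z : ℂ | z.im ∈ Set.uIcc 0 c})) :
    ∫ s : ℝ, gaussLine b c s • F s = ∫ s : ℝ, gaussLine b 0 s • F (s + c * I) := by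
  have hc0 : Continuous fun s : ℝ => F s := by
    refine hF.comp_continuous (by fun_prop) fun s => ?_
    simp
  have hc1 : Continuous fun s : ℝ => F (s + c * I) := by
    refine hF.comp_continuous (by fun_prop) fun s => ?_
    simp
  have i0 : Integrable fun s : ℝ => gaussLine b c s • F s :=
    integrable_gaussLine_smul hb c hc0 (fun s => hM _ (by simp))
  have i1 : Integrable fun s : ℝ => gaussLine b 0 s • F (s + c * I) :=
    integrable_gaussLine_smul hb 0 hc1 (fun s => hM _ (by simp))
  set H : ℂ → ℂ := fun z => cexp (-(b : ℂ) * (z - c * I) ^ 2) * F z with hH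
  have hrect : ∀ T : ℝ, ((∫ x : ℝ in (-T)..T, gaussLine b c x • F x) -
      ∫ x : ℝ in (-T)..T, gaussLine b 0 x • F (x + c * I)) +
      I • (∫ y : ℝ in (0 : ℝ)..c, H (T + y * I)) -
      I • (∫ y : ℝ in (0 : ℝ)..c, H ((-T : ℝ) + y * I)) = 0 := by
    intro T
    have := integral_boundary_rect_eq_zero_of_continuousOn_of_differentiableOn H
      ((-T : ℝ) : ℂ) (T + c * I) ?_ ?_
    · simpa [hH, gaussLine] using this
    · refine ContinuousOn.mul (by fun_prop) (hF.mono ?_)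
      intro z hz
      simpa using hz.2
    · refine DifferentiableOn.mul (by fun_prop) (hd.mono ?_)
      refine interior_maximal ?_ (isOpen_Ioo.reProdIm isOpen_Ioo)
      intro z hz
      have := hz.2
      simp only [ofReal_im, add_im, mul_im, ofReal_re, I_im, I_re, mul_zero,
        mul_one, add_zero, zero_add, Set.mem_preimage] at this
      exact ⟨this.1.le, this.2.le⟩
  have l0 := intervalIntegral_tendsto_integral i0 tendsto_neg_atTop_atBot tendsto_id
  have l1 := intervalIntegral_tendsto_integral i1 tendsto_neg_atTop_atBot tendsto_id
  have hsq : Tendsto (fun t : ℝ => t ^ 2) atTop atTop := tendsto_pow_atTop two_ne_zero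
  have v0 := tendsto_gauss_vertical (T := fun t => t) hb hM hsq
  have v1 := tendsto_gauss_vertical (T := fun t => -t) (l := atTop) hb hM (by simp [hsq])
  have lim := ((l0.sub l1).add (v0.const_smul I)).sub (v1.const_smul I)
  have := tendsto_nhds_unique (lim.congr fun T => hrect T) tendsto_const_nhds
  simpa [sub_eq_zero] using this

lemma IsKMSState.mem_smearedKMS {α : ℝ → A ≃⋆ₐ[ℂ] A}
    (hα : ∀ x : A, Continuous fun t : ℝ => α t x) {c : ℝ} {ω : A → ℂ} (h : IsKMSState α c ω) :
    ω ∈ smearedKMS α c := by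
  obtain ⟨h1, hlin, hpos, hkms⟩ := h
  have hs : IsStateFun ω := by
    refine ⟨h1, hlin, fun x => ?_⟩
    obtain ⟨r, hr, hx⟩ := hpos x
    simp [hx, hr]
  refine ⟨hs, fun b hb x y => ?_⟩
  split_ifs at hkms with hc
  · rw [hc]
    exact hkms.2 _ _
  obtain ⟨F, hF, ⟨M, hM⟩, hd, e0, e1⟩ := hkms x y
  have := integral_gaussLine_shift hb hF hM hd
  simp only [e0, e1] at this
  have a0 := map_smear hα (hs.toCLM ∘L ContinuousLinearMap.mul ℂ A x) hb c y
  have a1 := map_smear hα (hs.toCLM ∘L (ContinuousLinearMap.mul ℂ A).flip x) hb 0 y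
  simp only [ContinuousLinearMap.comp_apply, ContinuousLinearMap.mul_apply',
    ContinuousLinearMap.flip_apply, hs.toCLM_apply] at a0 a1
  rw [a0, a1, this]

omit [CStarRing A] [CompleteSpace A] [StarModule ℂ A] in
lemma convex_smearedKMS (α : ℝ → A ≃⋆ₐ[ℂ] A) (c : ℝ) : Convex ℝ (smearedKMS α c) := by
  rintro φ ⟨⟨f1, f2, f3⟩, f4⟩ ψ ⟨⟨g1, g2, g3⟩, g4⟩ p q hp hq hpq
  refine ⟨⟨?_, fun s x y => ?_, fun x => ?_⟩, fun b hb x y => ?_⟩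
  · simp only [Pi.add_apply, Pi.smul_apply, f1, g1, real_smul, mul_one]
    exact_mod_cast hpq
  · simp only [Pi.add_apply, Pi.smul_apply, f2, g2, real_smul]
    ring
  · simp only [Pi.add_apply, Pi.smul_apply, add_re, add_im, real_smul, re_ofReal_mul, im_ofReal_mul,
      (f3 x).2, (g3 x).2, mul_zero, add_zero, and_true]
    have := (f3 x).1
    have := (g3 x).1
    positivity
  · simp only [Pi.add_apply, Pi.smul_apply, f4 b hb, g4 b hb]

lemma isCompact_smearedKMS (α : ℝ → A ≃⋆ₐ[ℂ] A) (c : ℝ) : IsCompact (smearedKMS α c) := by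
  have hK : IsCompact (Set.univ.pi fun x : A => Metric.closedBall (0 : ℂ) (2 * ‖x‖)) :=
    isCompact_univ_pi fun x => isCompact_closedBall _ _
  refine hK.of_isClosed_subset ?_ fun ω hω x _ => ?_
  · simp only [smearedKMS, IsStateFun, Set.ofPred_and, Set.ofPred_forall]
    refine ((isClosed_eq (by fun_prop) (by fun_prop)).inter
      ((isClosed_iInter fun s => isClosed_iInter fun x => isClosed_iInter fun y =>
        isClosed_eq (by fun_prop) (by fun_prop)).inter
      (isClosed_iInter fun x => (isClosed_le (by fun_prop) (by fun_prop)).inter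
        (isClosed_eq (by fun_prop) (by fun_prop))))).inter
      (isClosed_iInter fun b => isClosed_iInter fun hb => isClosed_iInter fun x =>
        isClosed_iInter fun y => isClosed_eq (by fun_prop) (by fun_prop))
  · simpa using hω.1.norm_le x

lemma perturb_mem_smearedKMS {α : ℝ → A ≃⋆ₐ[ℂ] A} {c : ℝ} {ω : A → ℂ} (hω : ω ∈ smearedKMS α c)
    {U : Filter ℕ} [U.NeBot] {h : ℕ → A} (hsa : ∀ n, IsSelfAdjoint (h n))
    (hb : ∀ n, ‖h n‖ ≤ 1 / 2)
    (hcen : ∀ x, Tendsto (fun n => h n * x - x * h n) U (𝓝 0)) {χ : A → ℂ}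
    (hχ : ∀ x, Tendsto (fun n => ω (x * h n)) U (𝓝 (χ x))) :
    ∃ r : ℝ, χ 1 = r ∧ |r| ≤ 1 / 2 ∧ (fun x => ((1 + r)⁻¹ : ℝ) • (ω x + χ x)) ∈ smearedKMS α c := by
  have hs := hω.1
  have hmid : ∀ x y, Tendsto (fun n => ω (x * h n * y)) U (𝓝 (χ (x * y))) := by
    intro x y
    have h1 : Tendsto (fun n => hs.toCLM (x * (h n * y - y * h n))) U (𝓝 0) := by
      have : Tendsto (fun n => x * (h n * y - y * h n)) U (𝓝 0) := by
        simpa using (hcen y).const_mul x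
      simpa using! (hs.toCLM.continuous.tendsto 0).comp this
    have h2 := (hχ (x * y)).add h1
    rw [add_zero] at h2
    refine h2.congr fun n => ?_
    rw [← hs.toCLM_apply, ← hs.toCLM_apply, ← map_add]
    congr 1
    noncomm_ring
  have hpos : ∀ x, |(χ (star x * x)).re| ≤ 1 / 2 * (ω (star x * x)).re ∧
      (χ (star x * x)).im = 0 := by
    intro x
    have hx := hmid (star x) x
    refine ⟨le_of_tendsto ((continuous_re.tendsto _).comp hx).abs
      (.of_forall fun n => (hs.conj_bounds (hsa n) (hb n) x).1), ?_⟩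
    exact tendsto_nhds_unique ((continuous_im.tendsto _).comp hx)
      (tendsto_const_nhds.congr fun n => ((hs.conj_bounds (hsa n) (hb n) x).2).symm)
  have hlin : ∀ (s : ℂ) (x y : A), χ (s • x + y) = s * χ x + χ y := by
    intro s x y
    refine tendsto_nhds_unique (hχ _) ((((hχ x).const_mul s).add (hχ y)).congr fun n => ?_)
    rw [← hs.2.1, add_mul, smul_mul_assoc]
  have hone := hpos 1
  simp only [star_one, mul_one, hs.1, one_re] at hone
  refine ⟨(χ 1).re, Complex.ext rfl hone.2, hone.1, ⟨?_, fun s x y => ?_, fun x => ?_⟩,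
    fun b hb x y => ?_⟩
  · have h1 : χ 1 = ((χ 1).re : ℂ) := Complex.ext rfl hone.2
    have h2 : (1 + (χ 1).re) ≠ 0 := by linarith [(abs_le.1 hone.1).1]
    have h3 : ω 1 + χ 1 = ((1 + (χ 1).re : ℝ) : ℂ) := by rw [hs.1, h1]; simp
    change ((1 + (χ 1).re)⁻¹ : ℝ) • (ω 1 + χ 1) = 1
    rw [h3, real_smul, ← ofReal_mul, inv_mul_cancel₀ h2, ofReal_one]
  · simp only [hs.2.1, hlin, real_smul]
    ring
  · obtain ⟨p, q⟩ := hs.2.2 x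
    obtain ⟨p', q'⟩ := hpos x
    have h2 : 0 < (1 + (χ 1).re) := by linarith [(abs_le.1 hone.1).1]
    simp only [smul_re, smul_im, add_re, add_im, q, q', smul_eq_mul, add_zero, mul_zero, and_true]
    have : 0 ≤ (ω (star x * x)).re + (χ (star x * x)).re := by linarith [(abs_le.1 p').1]
    positivity
  · have h1 : χ (x * smear α b c y) = χ (smear α b 0 y * x) := by
      have h2 := hmid 1 (x * smear α b c y)
      rw [one_mul] at h2
      refine tendsto_nhds_unique h2 ((hmid (smear α b 0 y) x).congr fun n => ?_)
      rw [one_mul, ← mul_assoc, hω.2 b hb, mul_assoc]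
    simp only [h1, hω.2 b hb]

lemma tendsto_factor_of_isSelfAdjoint {α : ℝ → A ≃⋆ₐ[ℂ] A} {c : ℝ} {ω : A → ℂ}
    (hω : ω ∈ (smearedKMS α c).extremePoints ℝ)
    {h : ℕ → A} (hsa : ∀ n, IsSelfAdjoint (h n)) (hb : ∀ n, ‖h n‖ ≤ 1 / 2)
    (hcen : ∀ x, Tendsto (fun n => h n * x - x * h n) atTop (𝓝 0)) (x : A) :
    Tendsto (fun n => ω (x * h n) - ω (h n) * ω x) atTop (𝓝 0) := by
  have hs := hω.1.1
  rw [tendsto_iff_ultrafilter]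
  intro U hU
  have hex : ∀ y, ∃ l, Tendsto (fun n => ω (y * h n)) U (𝓝 l) := by
    intro y
    obtain ⟨l, -, hl⟩ := (isCompact_closedBall (0 : ℂ) (2 * (‖y‖ * (1 / 2)))).ultrafilter_le_nhds
      (U.map fun n => ω (y * h n)) (by
        rw [le_principal_iff, Ultrafilter.coe_map, mem_map]
        refine Filter.univ_mem' fun n => ?_
        simp only [Set.mem_preimage, Metric.mem_closedBall, dist_zero_right]
        refine (hs.norm_le _).trans ?_
        gcongr
        refine (norm_mul_le y (h n)).trans ?_
        gcongr
        exact hb n)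
    exact ⟨l, hl⟩
  choose χ hχ using hex
  obtain ⟨r, hr, hr', hp⟩ := perturb_mem_smearedKMS hω.1 hsa hb (fun x => (hcen x).mono_left hU) hχ
  obtain ⟨r', hm, -, hn⟩ := perturb_mem_smearedKMS (h := fun n => -h n) (χ := fun x => -χ x)
    (U := U) hω.1
    (fun n => (hsa n).neg) (fun n => by simpa using hb n)
    (fun x => by
      refine ((hcen x).mono_left hU).neg.congr' ?_ |>.trans (by simp)
      exact .of_forall fun n => by noncomm_ring)
    (fun x => by
      refine (hχ x).neg.congr fun n => ?_
      rw [← hs.toCLM_apply, ← hs.toCLM_apply, mul_neg, map_neg])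
  have hrr : r' = -r := by
    rw [hr] at hm
    exact_mod_cast hm.symm
  subst hrr
  obtain ⟨l1, l2⟩ := abs_le.1 hr'
  have p1 : (1 + r) ≠ 0 := by linarith
  have p2 : (1 + -r) ≠ 0 := by linarith
  have := hω.2 hp hn ⟨(1 + r) / 2, (1 + -r) / 2, by linarith, by linarith, by ring, by
    ext x
    have p1' : (1 + (r : ℂ)) ≠ 0 := by exact_mod_cast p1
    have p2' : (1 + -(r : ℂ)) ≠ 0 := by exact_mod_cast p2
    simp only [Pi.add_apply, Pi.smul_apply, real_smul]
    push_cast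
    field_simp
    ring⟩
  have hx : χ x = r * ω x := by
    have h1 := congrFun this x
    simp only [real_smul] at h1
    have p1' : (1 + (r : ℂ)) ≠ 0 := by exact_mod_cast p1
    push_cast at h1
    field_simp at h1
    linear_combination h1
  have h1 : Tendsto (fun n => ω (h n)) U (𝓝 (r : ℂ)) := by simpa [hr] using hχ 1
  simpa [hx] using (hχ x).sub (h1.mul_const (ω x))

lemma tendsto_factor {α : ℝ → A ≃⋆ₐ[ℂ] A} {c : ℝ} {ω : A → ℂ}
    (hω : ω ∈ (smearedKMS α c).extremePoints ℝ) {h : ℕ → A} {B : ℝ} (hb : ∀ n, ‖h n‖ ≤ B)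
    (hcen : ∀ x, Tendsto (fun n => h n * x - x * h n) atTop (𝓝 0)) (x : A) :
    Tendsto (fun n => ω (x * h n) - ω (h n) * ω x) atTop (𝓝 0) := by
  have hs := hω.1.1
  have hB : 0 ≤ B := (norm_nonneg _).trans (hb 0)
  set t : ℝ := 2 * (B + 1) with ht
  have ht0 : 0 < t := by positivity
  have hbt : ∀ n, ‖((t⁻¹ : ℝ) : ℂ) • h n‖ ≤ 1 / 2 := by
    intro n
    rw [norm_smul, norm_real, Real.norm_of_nonneg (by positivity), inv_mul_le_iff₀ ht0, ht]
    linarith [hb n]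
  set g : ℕ → A := fun n => ((t⁻¹ : ℝ) : ℂ) • h n with hg
  have gcen : ∀ x, Tendsto (fun n => g n * x - x * g n) atTop (𝓝 0) := by
    intro x
    have := (hcen x).const_smul ((t⁻¹ : ℝ) : ℂ)
    rw [smul_zero] at this
    refine this.congr fun n => ?_
    simp [hg, smul_sub]
  have gcen' : ∀ x, Tendsto (fun n => star (g n) * x - x * star (g n)) atTop (𝓝 0) := by
    intro x
    have := (gcen (star x)).star.neg
    rw [star_zero, neg_zero] at this
    refine this.congr fun n => ?_
    simp
  have h1 := tendsto_factor_of_isSelfAdjoint hω (h := fun n => (realPart (g n) : A))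
    (fun n => (realPart (g n)).2) (fun n => (realPart.norm_le _).trans (hbt n)) (fun x => by
      have := ((gcen x).add (gcen' x)).const_smul (2⁻¹ : ℂ)
      rw [add_zero, smul_zero] at this
      refine this.congr fun n => ?_
      have : (realPart (g n) : A) = (2⁻¹ : ℂ) • (g n + star (g n)) := by
        rw [realPart_apply_coe, ← coe_smul]
        simp
      rw [this]
      simp only [smul_mul_assoc, mul_smul_comm, add_mul, mul_add, smul_add, smul_sub]
      abel) x
  have h2 := tendsto_factor_of_isSelfAdjoint hω (h := fun n => (imaginaryPart (g n) : A))
    (fun n => (imaginaryPart (g n)).2) (fun n => (imaginaryPart.norm_le _).trans (hbt n))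
    (fun x => by
      have := ((gcen x).sub (gcen' x)).const_smul (-I * 2⁻¹ : ℂ)
      rw [sub_zero, smul_zero] at this
      refine this.congr fun n => ?_
      have : (imaginaryPart (g n) : A) = (-I * 2⁻¹ : ℂ) • (g n - star (g n)) := by
        rw [imaginaryPart_apply_coe, ← coe_smul, smul_smul]
        simp
      rw [this]
      simp only [smul_mul_assoc, mul_smul_comm, sub_mul, mul_sub, smul_sub]
      abel) x
  have h3 := ((h1.add (h2.const_mul I)).const_mul (t : ℂ))
  simp only [mul_zero, add_zero] at h3
  refine h3.congr fun n => ?_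
  have h4 : h n = (t : ℂ) • ((realPart (g n) : A) + I • (imaginaryPart (g n) : A)) := by
    rw [realPart_add_I_smul_imaginaryPart, hg, smul_smul]
    have : (t : ℂ) ≠ 0 := by exact_mod_cast ht0.ne'
    simp [this]
  simp only [← hs.toCLM_apply]
  rw [h4]
  simp only [mul_smul_comm, mul_add, map_smul, map_add, smul_eq_mul]
  ring

lemma norm_flow_sub_self_le {α : ℝ → A ≃⋆ₐ[ℂ] A}
    (hα0 : ∀ x : A, α 0 x = x) (hαadd : ∀ s t : ℝ, ∀ x : A, α (s + t) x = α s (α t x))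
    {u d : A} (hu : HasGenDeriv α u d) {M : ℝ} (hM : ‖d‖ ≤ M) (s : ℝ) :
    ‖α s u - u‖ ≤ M * |s| := by
  have hder : ∀ t, HasDerivAt (fun t => α t u) (α t d) t := by
    intro t
    rw [hasDerivAt_iff_tendsto_slope_zero]
    have hcont : Continuous (α t) := by
      refine continuous_of_linear_of_bound (𝕜 := ℂ) (map_add _) (map_smul _) (C := 1) fun x => ?_
      rw [(α t).norm_map_eq, one_mul]
    refine ((hcont.tendsto d).comp hu).congr fun r => ?_
    simp only [Function.comp_apply]
    rw [← coe_smul, ← coe_smul, map_smul, map_sub, hαadd]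
  have := convex_univ.norm_image_sub_le_of_norm_hasDerivWithin_le (x := 0) (y := s) (C := M)
    (fun t _ => (hder t).hasDerivWithinAt) (fun t _ => by rwa [(α t).norm_map_eq])
    (Set.mem_univ _) (Set.mem_univ _)
  simpa [hα0] using this

lemma integral_abs_mul_exp_neg_mul_sq {b : ℝ} (hb : 0 < b) :
    ∫ s : ℝ, |s| * Real.exp (-b * s ^ 2) = b⁻¹ := by
  have h1 := integral_mul_cexp_neg_mul_sq (b := (b : ℂ)) (by simpa using hb)
  have h2 : ∫ s : ℝ in Set.Ioi 0, s * Real.exp (-b * s ^ 2) = (2 * b)⁻¹ := by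
    have : ((∫ s : ℝ in Set.Ioi 0, s * Real.exp (-b * s ^ 2) : ℝ) : ℂ) = ((2 * b)⁻¹ : ℝ) := by
      rw [← integral_complex_ofReal]
      push_cast
      exact h1
    exact_mod_cast this
  have h3 := integral_comp_abs (f := fun s => s * Real.exp (-b * s ^ 2))
  simp only [sq_abs] at h3
  rw [h3, h2]
  field_simp

lemma norm_smear_sub_le {α : ℝ → A ≃⋆ₐ[ℂ] A} (hα : ∀ x : A, Continuous fun t : ℝ => α t x)
    {u : A} {M : ℝ} (hu : ∀ s, ‖α s u - u‖ ≤ M * |s|) {b : ℝ} (hb : 0 < b) :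
    ‖smear α b 0 u - (√(Real.pi / b) : ℂ) • u‖ ≤ M / b := by
  have hg : ∀ s, gaussLine b 0 s = (Real.exp (-b * s ^ 2) : ℂ) := by
    intro s
    simp [gaussLine]
  have h1 : (√(Real.pi / b) : ℂ) • u = ∫ s, gaussLine b 0 s • u := by
    rw [integral_smul_const, ← integral_gaussian, ← integral_complex_ofReal]
    simp only [hg]
  rw [h1, smear, ← integral_sub (integrable_smear hα hb 0 u)
    (integrable_gaussLine_smul hb 0 continuous_const (C := ‖u‖) fun _ => le_rfl)]
  have h2 : ∫ s : ℝ, M * (|s| * Real.exp (-b * s ^ 2)) = M / b := by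
    rw [integral_const_mul, integral_abs_mul_exp_neg_mul_sq hb, div_eq_mul_inv]
  rw [← h2]
  have h3 : Integrable fun s : ℝ => |s| * Real.exp (-b * s ^ 2) := by
    refine (integrable_mul_exp_neg_mul_sq hb).norm.congr (.of_forall fun s => ?_)
    simp
  refine norm_integral_le_of_norm_le (h3.const_mul M) (.of_forall fun s => ?_)
  rw [← smul_sub, norm_smul, norm_gaussLine]
  have := mul_le_mul_of_nonneg_left (hu s) (Real.exp_nonneg (-b * s ^ 2))
  simp only [ne_eq, OfNat.ofNat_ne_zero, not_false_eq_true, zero_pow, mul_zero, Real.exp_zero,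
    one_mul]
  linarith

lemma norm_smear_le {α : ℝ → A ≃⋆ₐ[ℂ] A} {u : A} (hu : ‖u‖ ≤ 1) {b : ℝ} (hb : 0 < b) (c : ℝ) :
    ‖smear α b c u‖ ≤ ∫ s, ‖gaussLine b c s‖ := by
  refine norm_integral_le_of_norm_le (integrable_norm_gaussLine hb c) (.of_forall fun s => ?_)
  rw [norm_smul, (α s).norm_map_eq]
  exact mul_le_of_le_one_right (norm_nonneg _) hu

omit [NormedAlgebra ℂ A] [CompleteSpace A] [StarModule ℂ A] in
lemma norm_unitary_mul_sub {u : A} (hu : u ∈ unitary A) (x y : A) :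
    ‖u * x - y * u‖ = ‖u * x * star u - y‖ := by
  rw [← CStarRing.norm_mul_mem_unitary (u * x * star u - y) hu, sub_mul, mul_assoc,
    (Unitary.mem_iff.1 hu).1, mul_one]

/-- The cocycle `u n * α s (u n)` of an approximating sequence of unitaries is asymptotically
central. -/
lemma tendsto_commutator_cocycle {α : ℝ → A ≃⋆ₐ[ℂ] A}
    (hα0 : ∀ x : A, α 0 x = x) (hαadd : ∀ s t : ℝ, ∀ x : A, α (s + t) x = α s (α t x))
    {σ : A ≃⋆ₐ[ℂ] A} (hcomm : ∀ t : ℝ, ∀ x : A, σ (α t x) = α t (σ x))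
    {u : ℕ → A} (hu : ∀ n, u n ∈ unitary A)
    (hσ : ∀ x : A, Tendsto (fun n => ‖u n * x * star (u n) - σ x‖) atTop (𝓝 0)) (s : ℝ) (x : A) :
    Tendsto (fun n => star (u n) * α s (u n) * x - x * (star (u n) * α s (u n))) atTop (𝓝 0) := by
  have hσ' : ∀ x, Tendsto (fun n => ‖u n * x - σ x * u n‖) atTop (𝓝 0) := fun x =>
    (hσ x).congr fun n => (norm_unitary_mul_sub (hu n) _ _).symm
  have hlim := (hσ' (α (-s) x)).add (hσ' x)
  rw [add_zero] at hlim
  refine squeeze_zero_norm (fun n => ?_) hlim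
  have hx : α s (α (-s) x) = x := by rw [← hαadd, add_neg_cancel, hα0]
  have e1 : star (u n) * α s (u n) * x - x * (star (u n) * α s (u n)) =
      star (u n) * α s (u n * α (-s) x - σ (α (-s) x) * u n) -
        star (u n) * (u n * x - σ x * u n) * star (u n) * α s (u n) := by
    have h1 := (Unitary.mem_iff.1 (hu n)).1
    have h2 := (Unitary.mem_iff.1 (hu n)).2
    rw [map_sub, map_mul, map_mul, ← hcomm, hx, mul_sub, mul_sub, ← mul_assoc (star (u n)) (u n), h1,
      one_mul, sub_mul, sub_mul]
    have h3 : star (u n) * (σ x * u n) * star (u n) = star (u n) * σ x := by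
      rw [mul_assoc, mul_assoc, h2, mul_one]
    rw [h3]
    noncomm_ring
  have hw : star (u n) ∈ unitary A := Unitary.star_mem (hu n)
  have ha : α s (u n) ∈ unitary A := by
    rw [Unitary.mem_iff, ← map_star, ← map_mul, ← map_mul, (Unitary.mem_iff.1 (hu n)).1,
      (Unitary.mem_iff.1 (hu n)).2, map_one]
    exact ⟨rfl, rfl⟩
  rw [e1]
  refine (norm_sub_le _ _).trans (le_of_eq ?_)
  rw [CStarRing.norm_mem_unitary_mul _ hw, (α s).norm_map_eq,
    CStarRing.norm_mul_mem_unitary _ ha, CStarRing.norm_mul_mem_unitary _ hw,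
    CStarRing.norm_mem_unitary_mul _ hw]

lemma tendsto_commutator_smear {α : ℝ → A ≃⋆ₐ[ℂ] A}
    (hα : ∀ x : A, Continuous fun t : ℝ => α t x) {u : ℕ → A} (hu : ∀ n, u n ∈ unitary A)
    (hcen : ∀ (s : ℝ) (x : A), Tendsto
      (fun n => star (u n) * α s (u n) * x - x * (star (u n) * α s (u n))) atTop (𝓝 0))
    {b : ℝ} (hb : 0 < b) (c : ℝ) (x : A) :
    Tendsto (fun n => star (u n) * smear α b c (u n) * x - x * (star (u n) * smear α b c (u n)))
      atTop (𝓝 0) := by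
  let L : ℕ → A →L[ℂ] A := fun n =>
    (ContinuousLinearMap.mul ℂ A).flip x ∘L ContinuousLinearMap.mul ℂ A (star (u n)) -
      ContinuousLinearMap.mul ℂ A x ∘L ContinuousLinearMap.mul ℂ A (star (u n))
  have hL : ∀ n y, L n y = star (u n) * y * x - x * (star (u n) * y) := fun n y => rfl
  have hLn : ∀ n s, ‖L n (α s (u n))‖ ≤ 2 * ‖x‖ := by
    intro n s
    have h1 : ‖star (u n) * α s (u n)‖ ≤ 1 := by
      rw [CStarRing.norm_mem_unitary_mul _ (Unitary.star_mem (hu n)), (α s).norm_map_eq]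
      exact norm_le_one_of_mem_unitary (hu n)
    rw [hL]
    refine (norm_sub_le _ _).trans ?_
    have h2 := norm_mul_le (star (u n) * α s (u n)) x
    have h3 := norm_mul_le x (star (u n) * α s (u n))
    nlinarith [norm_nonneg x]
  have key : Tendsto (fun n => ∫ s : ℝ, gaussLine b c s • L n (α s (u n))) atTop
      (𝓝 (∫ _ : ℝ, (0 : A))) := by
    refine tendsto_integral_of_dominated_convergence (fun s => ‖gaussLine b c s‖ * (2 * ‖x‖))
      (fun n => ?_) ((integrable_norm_gaussLine hb c).mul_const _)
      (fun n => .of_forall fun s => ?_) (.of_forall fun s => ?_)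
    · exact ((continuous_gaussLine b c).smul
        ((L n).continuous.comp (hα (u n)))).aestronglyMeasurable
    · rw [norm_smul]
      gcongr
      exact hLn n s
    · simpa [hL] using (hcen s x).const_smul (gaussLine b c s)
  rw [integral_zero] at key
  refine key.congr fun n => ?_
  rw [← map_smear hα (L n) hb c (u n), hL]

lemma norm_sub_le_of_extreme {α : ℝ → A ≃⋆ₐ[ℂ] A} (hα : ∀ x : A, Continuous fun t : ℝ => α t x)
    {c : ℝ} {ω : A → ℂ} (hω : ω ∈ (smearedKMS α c).extremePoints ℝ) {σ : A ≃⋆ₐ[ℂ] A}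
    {u : ℕ → A} (hu : ∀ n, u n ∈ unitary A)
    (hσ : ∀ x : A, Tendsto (fun n => ‖u n * x * star (u n) - σ x‖) atTop (𝓝 0))
    (hcen : ∀ (s : ℝ) (x : A), Tendsto
      (fun n => star (u n) * α s (u n) * x - x * (star (u n) * α s (u n))) atTop (𝓝 0))
    {M : ℝ} (hM : ∀ n s, ‖α s (u n) - u n‖ ≤ M * |s|) {b : ℝ} (hb : 0 < b) (x : A) :
    √(Real.pi / b) * ‖ω (σ x) - ω x‖ ≤ 2 * (M / b) * (‖x‖ + ‖ω x‖) := by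
  have hs := hω.1.1
  set ν : ℝ := √(Real.pi / b) with hν
  set h : ℕ → A := fun n => star (u n) * smear α b c (u n) with hh
  have hbd : ∀ n, ‖h n‖ ≤ ∫ s, ‖gaussLine b c s‖ := fun n => by
    rw [hh, CStarRing.norm_mem_unitary_mul _ (Unitary.star_mem (hu n))]
    exact norm_smear_le (norm_le_one_of_mem_unitary (hu n)) hb c
  have hfac := tendsto_factor hω hbd (tendsto_commutator_smear hα hu hcen hb c) x
  have hconj : Tendsto (fun n => ω (u n * x * star (u n))) atTop (𝓝 (ω (σ x))) :=
    (hs.toCLM.continuous.tendsto _).comp (tendsto_iff_norm_sub_tendsto_zero.2 (hσ x))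
  have happrox : ∀ n y, ‖ω (y * h n) - ν * ω (u n * y * star (u n))‖ ≤ 2 * (M / b * ‖y‖) := by
    intro n y
    have h1 : ω (y * h n) = ω (smear α b 0 (u n) * (y * star (u n))) := by
      rw [hh, ← hω.1.2 b hb, mul_assoc]
    have h2 : ω (y * h n) - ν * ω (u n * y * star (u n)) =
        ω ((smear α b 0 (u n) - (ν : ℂ) • u n) * y * star (u n)) := by
      rw [h1]
      simp only [← hs.toCLM_apply]
      simp only [sub_mul, smul_mul_assoc, map_sub, map_smul, smul_eq_mul, mul_assoc]
    rw [h2]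
    refine (hs.norm_le _).trans ?_
    rw [CStarRing.norm_mul_mem_unitary _ (Unitary.star_mem (hu n))]
    gcongr
    refine (norm_mul_le _ _).trans ?_
    gcongr
    exact norm_smear_sub_le hα (hM n) hb
  have hone : ∀ n, ‖ω (h n) - ν‖ ≤ 2 * (M / b) := by
    intro n
    have h1 := happrox n 1
    have h2 : ‖(1 : A)‖ ≤ 1 := norm_le_one_of_mem_unitary (one_mem _)
    have hM0 : 0 ≤ M / b := (norm_nonneg _).trans (norm_smear_sub_le hα (hM n) hb)
    rw [one_mul, mul_one, (Unitary.mem_iff.1 (hu n)).2, hs.1, mul_one] at h1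
    nlinarith
  have hlim := ((hconj.sub_const (ω x)).norm.const_mul ν)
  have hlim' := (hfac.norm).const_add (2 * (M / b) * (‖x‖ + ‖ω x‖))
  rw [norm_zero, add_zero] at hlim'
  refine le_of_tendsto_of_tendsto' hlim hlim' fun n => ?_
  have hν0 : 0 ≤ ν := Real.sqrt_nonneg _
  have e1 : (ν : ℂ) * (ω (u n * x * star (u n)) - ω x) =
      -(ω (x * h n) - ν * ω (u n * x * star (u n))) + (ω (h n) - ν) * ω x +
        (ω (x * h n) - ω (h n) * ω x) := by ring
  calc ν * ‖ω (u n * x * star (u n)) - ω x‖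
      = ‖(ν : ℂ) * (ω (u n * x * star (u n)) - ω x)‖ := by
        rw [norm_mul, norm_real, Real.norm_of_nonneg hν0]
    _ ≤ ‖ω (x * h n) - ν * ω (u n * x * star (u n))‖ + ‖ω (h n) - ν‖ * ‖ω x‖ +
        ‖ω (x * h n) - ω (h n) * ω x‖ := by
        rw [e1, ← norm_neg (ω (x * h n) - _), ← norm_mul]
        exact norm_add₃_le
    _ ≤ _ := by
        have h1 := happrox n x
        have h2 := mul_le_mul_of_nonneg_right (hone n) (norm_nonneg (ω x))
        linarith

lemma eq_of_forall_sqrt_mul_norm_le {z w : ℂ} {K : ℝ}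
    (h : ∀ b : ℝ, 0 < b → √(Real.pi / b) * ‖z - w‖ ≤ K / b) : z = w := by
  have h1 : ∀ t : ℝ, 0 < t → √Real.pi * ‖z - w‖ ≤ K * t⁻¹ := by
    intro t ht
    have := h (t ^ 2) (by positivity)
    rw [Real.sqrt_div Real.pi_pos.le, Real.sqrt_sq ht.le] at this
    field_simp at this ⊢
    linarith
  have h2 : Tendsto (fun t : ℝ => K * t⁻¹) atTop (𝓝 0) := by
    simpa using tendsto_inv_atTop_zero.const_mul K
  have h3 : √Real.pi * ‖z - w‖ ≤ 0 :=
    ge_of_tendsto h2 ((eventually_gt_atTop 0).mono h1)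
  have h4 : 0 < √Real.pi := Real.sqrt_pos.2 Real.pi_pos
  have h5 : ‖z - w‖ ≤ 0 := by
    by_contra! h5
    exact absurd h3 (not_le.2 (by positivity))
  exact sub_eq_zero.1 (norm_le_zero_iff.1 h5)

end SmearedKMS

/-- If `σ` is an automorphism commuting with a flow `α` on a
unital C*-algebra and `σ` is `α`-smoothly approximately inner, then every
`α`-KMS state (at any inverse temperature) is `σ`-invariant. -/
theorem kms_state_invariant_of_smoothly_approximately_inner {A : Type*}
    [NormedRing A] [StarRing A] [CStarRing A] [NormedAlgebra ℂ A] [CompleteSpace A]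
    [StarModule ℂ A]
    (α : ℝ → A ≃⋆ₐ[ℂ] A)
    (hα0 : ∀ x : A, α 0 x = x)
    (hαadd : ∀ s t : ℝ, ∀ x : A, α (s + t) x = α s (α t x))
    (hαcont : ∀ x : A, Continuous fun t : ℝ => α t x)
    (σ : A ≃⋆ₐ[ℂ] A)
    (hcomm : ∀ t : ℝ, ∀ x : A, σ (α t x) = α t (σ x))
    -- `σ` is `α`-smoothly approximately inner
    (hsmooth : ∃ (u : ℕ → A) (d : ℕ → A), (∀ n, u n ∈ unitary A) ∧
      (∀ n, HasGenDeriv α (u n) (d n)) ∧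
      (∀ x : A, Tendsto (fun n => ‖u n * x * star (u n) - σ x‖) atTop (𝓝 0)) ∧
      (∃ M : ℝ, ∀ n, ‖d n‖ ≤ M)) :
    ∀ (c : ℝ) (ω : A → ℂ), IsKMSState α c ω → ∀ x : A, ω (σ x) = ω x := by
  obtain ⟨u, d, hu, hd, hσ, M, hM⟩ := hsmooth
  intro c ω hω x
  have hext : ∀ φ ∈ (smearedKMS α c).extremePoints ℝ, ∀ x, φ (σ x) = φ x := by
    intro φ hφ x
    refine eq_of_forall_sqrt_mul_norm_le (K := 2 * M * (‖x‖ + ‖φ x‖)) fun b hb => ?_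
    refine (norm_sub_le_of_extreme hαcont hφ hu hσ
      (tendsto_commutator_cocycle hα0 hαadd hcomm hu hσ)
      (fun n => norm_flow_sub_self_le hα0 hαadd (hd n) (hM n)) hb x).trans (le_of_eq ?_)
    ring
  have hmem := hω.mem_smearedKMS hαcont
  rw [← closure_convexHull_extremePoints (isCompact_smearedKMS α c) (convex_smearedKMS α c)]
    at hmem
  have hclosed : IsClosed {φ : A → ℂ | φ (σ x) = φ x} :=
    isClosed_eq (by fun_prop) (by fun_prop)
  have hconv : Convex ℝ {φ : A → ℂ | φ (σ x) = φ x} := by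
    intro φ hφ ψ hψ p q _ _ _
    simp only [Set.mem_ofPred_eq, Pi.add_apply, Pi.smul_apply] at hφ hψ ⊢
    rw [hφ, hψ]
  exact closure_minimal (convexHull_min (fun φ hφ => hext φ hφ x) hconv) hclosed hmem
end

section
/- Let A be a unital C*-algebra, let α be a compact flow on A, let π be a faithful irreducible representation of A on a Hilbert space H, and let U : ℝ → B(H) be a strongly continuous one-parameter group of unitaries such that U_t π(x) U_t* = π(α_t(x)) for all x ∈ A and t ∈ ℝ. Let A^α = {x ∈ A : α_t(x) = x for all t} be the fixed-point algebra, and let h be a self-adjoint element of A^α such that H has an orthonormal basis consisting of eigenvectors of π(h) and every eigenvalue of π(h) has a one-dimensional eigenspace. Then every maximal abelian C*-subalgebra C of A^α with h ∈ C is a maximal abelian C*-subalgebra of A; that is, every element of A commuting with all elements of C belongs to C. -/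
open Filter Topology

/-- An operator commuting with `T` maps a nonzero eigenvector of `T` spanning its eigenspace to a
multiple of itself. -/
theorem exists_smul_eq_of_commute_of_rank_eigenspace_le_one {K E : Type*} [Field K]
    [AddCommGroup E] [Module K E] {S T : Module.End K E} (hST : Commute S T) {μ : K}
    (hμ : Module.rank K (Module.End.eigenspace T μ) ≤ 1) {v : E} (hv : T v = μ • v)
    (hv0 : v ≠ 0) : ∃ c : K, S v = c • v := by
  obtain ⟨w, -, hw⟩ := (rank_submodule_le_one_iff _).1 hμ
  have hvw := hw (Module.End.mem_eigenspace_iff.2 hv)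
  have hSv : T (S v) = μ • S v := by
    rw [← Module.End.mul_apply, ← hST.eq, Module.End.mul_apply, hv, map_smul]
  have hSw := hw (Module.End.mem_eigenspace_iff.2 hSv)
  obtain ⟨a, ha⟩ := Submodule.mem_span_singleton.1 hvw
  obtain ⟨b, hb⟩ := Submodule.mem_span_singleton.1 hSw
  have ha0 : a ≠ 0 := by
    rintro rfl
    exact hv0 (by simpa using ha.symm)
  exact ⟨b * a⁻¹, by rw [← hb, ← ha, smul_smul, inv_mul_cancel_right₀ ha0]⟩

/-- Two bounded operators having every vector of a Hilbert basis as an eigenvector commute. -/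
theorem HilbertBasis.commute_of_forall_exists_smul_eq {𝕜 ι E : Type*} [RCLike 𝕜]
    [NormedAddCommGroup E] [InnerProductSpace 𝕜 E] (b : HilbertBasis ι 𝕜 E) {S T : E →L[𝕜] E}
    (hS : ∀ i, ∃ c : 𝕜, S (b i) = c • b i) (hT : ∀ i, ∃ c : 𝕜, T (b i) = c • b i) :
    Commute S T := by
  refine ContinuousLinearMap.ext_on
    (Submodule.dense_iff_topologicalClosure_eq_top.2 b.dense_span) ?_
  rintro _ ⟨i, rfl⟩
  obtain ⟨c, hc⟩ := hS i
  obtain ⟨d, hd⟩ := hT i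
  simp [hc, hd, smul_smul, mul_comm]

/-- Let `α` be a compact flow on a unital C*-algebra `A`, `π` a
faithful irreducible covariant representation on `H` with a strongly continuous
unitary group `U`, and `h` a self-adjoint element of the fixed-point algebra `A^α`
such that `π h` is diagonal with one-dimensional eigenspaces. Then every maximal
abelian C*-subalgebra `C` of `A^α` containing `h` is maximal abelian in `A`. -/
theorem masa_of_fixed_point_algebra_is_masa {A : Type*} [NormedRing A] [StarRing A]
    [CStarRing A] [NormedAlgebra ℂ A] [CompleteSpace A] [StarModule ℂ A]
    {H : Type*} [NormedAddCommGroup H] [InnerProductSpace ℂ H] [CompleteSpace H]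
    -- the flow
    (α : ℝ → A ≃⋆ₐ[ℂ] A)
    (hα0 : ∀ x : A, α 0 x = x)
    (hαadd : ∀ s t : ℝ, ∀ x : A, α (s + t) x = α s (α t x))
    (hαcont : ∀ x : A, Continuous fun t : ℝ => α t x)
    -- the flow is compact
    (hcompact : ∀ x : A, IsCompact (closure (Set.range fun t : ℝ => α t x)))
    -- a faithful irreducible representation
    (π : A →⋆ₐ[ℂ] (H →L[ℂ] H))
    (hfaith : Function.Injective π)
    (hirr : ∀ V : Submodule ℂ H, IsClosed (V : Set H) →
      (∀ a : A, ∀ ξ ∈ V, π a ξ ∈ V) → V = ⊥ ∨ V = ⊤)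
    -- a strongly continuous covariant one-parameter unitary group
    (U : ℝ → (H →L[ℂ] H))
    (hUunit : ∀ t : ℝ, U t ∈ unitary (H →L[ℂ] H))
    (hUadd : ∀ s t : ℝ, U (s + t) = U s * U t)
    (hUcont : ∀ ξ : H, Continuous fun t : ℝ => U t ξ)
    (hcov : ∀ (t : ℝ) (x : A), U t * π x * star (U t) = π (α t x))
    -- a self-adjoint fixed element with diagonal, multiplicity-free image
    (h : A) (hsa : IsSelfAdjoint h) (hfix : ∀ t : ℝ, α t h = h)
    (hdiag : ∃ (ι : Type) (b : HilbertBasis ι ℂ H), ∀ i : ι,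
      ∃ μ : ℝ, π h (b i) = (μ : ℂ) • b i)
    (hsimple : ∀ μ : ℂ, Module.rank ℂ (Module.End.eigenspace
      ((π h : H →L[ℂ] H) : H →ₗ[ℂ] H) μ) ≤ 1) :
    -- every masa of the fixed-point algebra containing `h` is a masa of `A`
    ∀ C : StarSubalgebra ℂ A,
      (∀ x ∈ C, ∀ t : ℝ, α t x = x) →
      (∀ x ∈ C, ∀ y ∈ C, x * y = y * x) →
      (∀ z : A, (∀ t : ℝ, α t z = z) → (∀ x ∈ C, z * x = x * z) → z ∈ C) →
      h ∈ C →
      ∀ z : A, (∀ x ∈ C, z * x = x * z) → z ∈ C := by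
  intro C _ _ hmax hC z hz
  obtain ⟨ι, b, hb⟩ := hdiag
  have diag : ∀ S : H →L[ℂ] H, Commute S (π h) → ∀ i, ∃ c : ℂ, S (b i) = c • b i := by
    intro S hS i
    obtain ⟨μ, hμ⟩ := hb i
    refine exists_smul_eq_of_commute_of_rank_eigenspace_le_one
      (S := (S : H →ₗ[ℂ] H)) (T := (π h : H →ₗ[ℂ] H)) ?_ (hsimple μ) hμ
      (b.orthonormal.ne_zero i)
    exact LinearMap.ext fun v => congrArg (fun R : H →L[ℂ] H => R v) hS.eq
  have commute_of_fixed : ∀ t : ℝ, Commute (U t) (π h) := by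
    intro t
    have key := hcov t h
    rw [hfix t] at key
    calc U t * π h = U t * π h * (star (U t) * U t) := by
          rw [Unitary.star_mul_self_of_mem (hUunit t), mul_one]
      _ = π h * U t := by rw [← mul_assoc, key]
  have hzh : Commute (π z) (π h) := by
    change π z * π h = π h * π z
    rw [← map_mul, hz h hC, map_mul]
  refine hmax z (fun t => hfaith ?_) hz
  have hUz : Commute (U t) (π z) :=
    b.commute_of_forall_exists_smul_eq (diag _ (commute_of_fixed t)) (diag _ hzh)
  rw [← hcov, hUz.eq, mul_assoc, Unitary.mul_star_self_of_mem (hUunit t), mul_one]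
end
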